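/- Under the stated setting, assume conditions (3.3), (3.4), (3.5) hold for constants M, R, K, ω, δ > 0, and let k : ℝⁿ → ℝ be any locally bounded function with k(0) = 0. Then there exist r̃ > 0 and μ > 0 such that the set S = {(x,y) ∈ ℝⁿ×ℝ : x'Px < R² and |y + c'x| ≤ ω⁻¹} is positively invariant for the closed-loop system (3.7): for every sampling schedule with MASP r̃, every measurable d : [0,∞) → D, and every solution (x,y) of (3.7) with (x(0),y(0)) ∈ S, one has (x(t),y(t)) ∈ S for all t ≥ 0 and moreover V(t) ≤ exp(−μt)·V(0) for all t ≥ 0, where V(t) := (M/2)(y(t)+c'x(t))² + (1/2)x(t)'Px(t). -/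

import Mathlib

open Matrix MeasureTheory Set Filter

noncomputable section

/-- The `m × m` matrix with ones on the subdiagonal and zeros elsewhere. -/
def matA (m : ℕ) : Matrix (Fin m) (Fin m) ℝ :=
  Matrix.of fun i j => if (i : ℕ) = (j : ℕ) + 1 then 1 else 0

/-- The vector `b = (1,0,…,0)'` as a plain function. -/
def vecbf (m : ℕ) : Fin m → ℝ := fun i => if (i : ℕ) = 0 then 1 else 0

/-- The vector `b = (1,0,…,0)'` in Euclidean space. -/
def vecb (m : ℕ) : EuclideanSpace ℝ (Fin m) := (WithLp.equiv 2 (Fin m → ℝ)).symm (vecbf m)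

/-- View a Euclidean vector as a plain function. -/
def ef {m : ℕ} (x : EuclideanSpace ℝ (Fin m)) : Fin m → ℝ := x

/-- Matrix-vector multiplication on Euclidean space. -/
def mulVecE {m : ℕ} (M : Matrix (Fin m) (Fin m) ℝ) (x : EuclideanSpace ℝ (Fin m)) :
    EuclideanSpace ℝ (Fin m) :=
  (WithLp.equiv 2 (Fin m → ℝ)).symm (M.mulVec (ef x))

/-- Euclidean inner product `x'y`. -/
def ip {m : ℕ} (x y : EuclideanSpace ℝ (Fin m)) : ℝ := ∑ i, x i * y i

/-- Quadratic form `x'Px`. -/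
def qf {m : ℕ} (P : Matrix (Fin m) (Fin m) ℝ) (x : EuclideanSpace ℝ (Fin m)) : ℝ :=
  ip x (mulVecE P x)

/-- The saturation function `sat(s) = s / max(1,|s|)`. -/
def sat (s : ℝ) : ℝ := s / max 1 |s|

/-- The vector `c = -(A' + pb')⁻¹ (0,…,0,1)'`. -/
def cvec (n : ℕ) (p : EuclideanSpace ℝ (Fin (n+1))) : EuclideanSpace ℝ (Fin (n+1)) :=
  (WithLp.equiv 2 (Fin (n+1) → ℝ)).symm
    (-((((matA (n+1))ᵀ + vecMulVec (ef p) (vecbf (n+1)))⁻¹).mulVec (Pi.single (Fin.last n) 1)))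

/-- Condition (3.3): `x'P(Ax + f(d,x,u) + bu) < 0` whenever `d ∈ D`, `x'Px = R²` and
`|u - p'x| ≤ K|c'b|`. -/
def Cond33 {l n : ℕ} (D : Set (EuclideanSpace ℝ (Fin l)))
    (f : EuclideanSpace ℝ (Fin l) → EuclideanSpace ℝ (Fin (n+1)) → ℝ → EuclideanSpace ℝ (Fin (n+1)))
    (P : Matrix (Fin (n+1)) (Fin (n+1)) ℝ) (p : EuclideanSpace ℝ (Fin (n+1))) (R K : ℝ) : Prop :=
  ∀ d ∈ D, ∀ x : EuclideanSpace ℝ (Fin (n+1)), ∀ u : ℝ,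
    qf P x = R ^ 2 → |u - ip p x| ≤ K * |ip (cvec n p) (vecb (n+1))| →
      ip x (mulVecE P (mulVecE (matA (n+1)) x + f d x u + u • vecb (n+1))) < 0

/-- Condition (3.4): `|g(d,x,u) + c'f(d,x,u)| < K(c'b)²` whenever `d ∈ D`, `x'Px ≤ R²` and
`|u - p'x| ≤ K|c'b|`. -/
def Cond34 {l n : ℕ} (D : Set (EuclideanSpace ℝ (Fin l)))
    (f : EuclideanSpace ℝ (Fin l) → EuclideanSpace ℝ (Fin (n+1)) → ℝ → EuclideanSpace ℝ (Fin (n+1)))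
    (g : EuclideanSpace ℝ (Fin l) → EuclideanSpace ℝ (Fin (n+1)) → ℝ → ℝ)
    (P : Matrix (Fin (n+1)) (Fin (n+1)) ℝ) (p : EuclideanSpace ℝ (Fin (n+1))) (R K : ℝ) : Prop :=
  ∀ d ∈ D, ∀ x : EuclideanSpace ℝ (Fin (n+1)), ∀ u : ℝ,
    qf P x ≤ R ^ 2 → |u - ip p x| ≤ K * |ip (cvec n p) (vecb (n+1))| →
      |g d x u + ip (cvec n p) (f d x u)| < K * (ip (cvec n p) (vecb (n+1))) ^ 2

/-- Condition (3.5). -/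
def Cond35 {l n : ℕ} (D : Set (EuclideanSpace ℝ (Fin l)))
    (f : EuclideanSpace ℝ (Fin l) → EuclideanSpace ℝ (Fin (n+1)) → ℝ → EuclideanSpace ℝ (Fin (n+1)))
    (g : EuclideanSpace ℝ (Fin l) → EuclideanSpace ℝ (Fin (n+1)) → ℝ → ℝ)
    (P : Matrix (Fin (n+1)) (Fin (n+1)) ℝ) (p : EuclideanSpace ℝ (Fin (n+1)))
    (M R K ω δ : ℝ) : Prop :=
  ∀ d ∈ D, ∀ x : EuclideanSpace ℝ (Fin (n+1)), ∀ z : ℝ,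
    qf P x ≤ R ^ 2 → ω * |z| ≤ 1 →
      ∀ u : ℝ, u = ip p x - K * ip (cvec n p) (vecb (n+1)) * ω * z →
        z * (M * g d x u + M * ip (cvec n p) (f d x u)
              - K * ip (cvec n p) (vecb (n+1)) * ω * ip (vecb (n+1)) (mulVecE P x))
          ≤ (M * K * (ip (cvec n p) (vecb (n+1))) ^ 2 * ω - δ) * z ^ 2
            - ip x (mulVecE P
                (mulVecE (matA (n+1) + vecMulVec (vecbf (n+1)) (ef p) + δ • 1) x + f d x u))

/-- A sampling schedule with maximum allowable sampling period `r`. -/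
def Sched (r : ℝ) (τ : ℕ → ℝ) : Prop :=
  τ 0 = 0 ∧ (∀ i, 0 < τ (i+1) - τ i) ∧ (∀ i, τ (i+1) - τ i ≤ r) ∧
    Tendsto τ atTop atTop

open Classical in
/-- The hybrid feedback `k̃` of (3.6). -/
def ktilde {n : ℕ} (k : EuclideanSpace ℝ (Fin (n+1)) → ℝ)
    (P : Matrix (Fin (n+1)) (Fin (n+1)) ℝ) (p : EuclideanSpace ℝ (Fin (n+1)))
    (R K ω : ℝ) (x : EuclideanSpace ℝ (Fin (n+1))) (y : ℝ) : ℝ :=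
  if R ^ 2 ≤ qf P x then k x
  else ip p x - K * ip (cvec n p) (vecb (n+1)) * sat (ω * (y + ip (cvec n p) x))

/-- A (locally absolutely continuous) solution of the closed-loop sampled-data system (3.7)
with feedback `fb`, sampling times `τ` and disturbance `d`. -/
def Sol37 {l n : ℕ}
    (f : EuclideanSpace ℝ (Fin l) → EuclideanSpace ℝ (Fin (n+1)) → ℝ → EuclideanSpace ℝ (Fin (n+1)))
    (g : EuclideanSpace ℝ (Fin l) → EuclideanSpace ℝ (Fin (n+1)) → ℝ → ℝ)
    (fb : EuclideanSpace ℝ (Fin (n+1)) → ℝ → ℝ) (τ : ℕ → ℝ)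
    (d : ℝ → EuclideanSpace ℝ (Fin l))
    (x : ℝ → EuclideanSpace ℝ (Fin (n+1))) (y : ℝ → ℝ) : Prop :=
  ∃ (x' : ℝ → EuclideanSpace ℝ (Fin (n+1))) (y' : ℝ → ℝ),
    (∀ T : ℝ, IntervalIntegrable x' volume 0 T) ∧
    (∀ T : ℝ, IntervalIntegrable y' volume 0 T) ∧
    (∀ t : ℝ, 0 ≤ t → x t = x 0 + ∫ s in (0:ℝ)..t, x' s) ∧
    (∀ t : ℝ, 0 ≤ t → y t = y 0 + ∫ s in (0:ℝ)..t, y' s) ∧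
    ∀ i : ℕ, ∀ᵐ t ∂(volume.restrict (Ico (τ i) (τ (i+1)))),
      x' t = mulVecE (matA (n+1)) (x t) + f (d t) (x t) (fb (x (τ i)) (y (τ i)))
          + fb (x (τ i)) (y (τ i)) • vecb (n+1) ∧
      y' t = x t (Fin.last n) + g (d t) (x t) (fb (x (τ i)) (y (τ i)))

open Topology RealInnerProductSpace

/-- On a compact set, a continuous function that is negative on the zero set of a nonnegative
continuous function is bounded above by `-ε + C * ψ`. -/
lemma IsCompact.exists_le_neg_add_mul {X : Type*} [TopologicalSpace X] {s : Set X}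
    (hs : IsCompact s) {φ ψ : X → ℝ} (hφ : Continuous φ) (hψ : Continuous ψ)
    (hψ0 : ∀ q ∈ s, 0 ≤ ψ q) (hneg : ∀ q ∈ s, ψ q = 0 → φ q < 0) :
    ∃ ε > 0, ∃ C ≥ 0, ∀ q ∈ s, φ q ≤ -ε + C * ψ q := by
  obtain ⟨ε, hε, hεs⟩ : ∃ ε > 0, ∀ q ∈ s, ψ q = 0 → φ q < -ε := by
    have hs0 : IsCompact (s ∩ {q | ψ q = 0}) :=
      hs.inter_right (isClosed_eq hψ continuous_const)
    rcases (s ∩ {q | ψ q = 0}).eq_empty_or_nonempty with h | h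
    · exact ⟨1, one_pos, fun q hq hq0 => (h.subset ⟨hq, hq0⟩).elim⟩
    · obtain ⟨q₀, hq₀, hmax⟩ := hs0.exists_isMaxOn h hφ.continuousOn
      have h0 := hneg q₀ hq₀.1 hq₀.2
      refine ⟨-φ q₀ / 2, by linarith, fun q hq hq0 => ?_⟩
      have h1 : φ q ≤ φ q₀ := hmax ⟨hq, hq0⟩
      linarith
  have hs1 : IsCompact (s ∩ {q | -ε ≤ φ q}) :=
    hs.inter_right (isClosed_le continuous_const hφ)
  rcases (s ∩ {q | -ε ≤ φ q}).eq_empty_or_nonempty with h | h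
  · refine ⟨ε, hε, 0, le_rfl, fun q hq => ?_⟩
    by_contra hcon
    exact h.subset ⟨hq, show -ε ≤ φ q by linarith⟩
  · obtain ⟨q₀, hq₀, hmin⟩ := hs1.exists_isMinOn h hψ.continuousOn
    obtain ⟨q₁, hq₁, hmax⟩ := hs1.exists_isMaxOn h hφ.continuousOn
    have hη : 0 < ψ q₀ := by
      refine lt_of_le_of_ne (hψ0 q₀ hq₀.1) fun h0 => ?_
      have h1 := hεs q₀ hq₀.1 h0.symm
      have h2 : -ε ≤ φ q₀ := hq₀.2
      linarith
    have hB : 0 ≤ φ q₁ + ε := by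
      have h2 : -ε ≤ φ q₁ := hq₁.2
      linarith
    refine ⟨ε, hε, (φ q₁ + ε) / ψ q₀, by positivity, fun q hq => ?_⟩
    by_cases hq1 : -ε ≤ φ q
    · have h1 : φ q ≤ φ q₁ := hmax ⟨hq, hq1⟩
      have h2 : ψ q₀ ≤ ψ q := hmin ⟨hq, hq1⟩
      have h3 : (φ q₁ + ε) / ψ q₀ * ψ q₀ ≤ (φ q₁ + ε) / ψ q₀ * ψ q := by gcongr
      rw [div_mul_cancel₀ _ hη.ne'] at h3
      linarith
    · have : 0 ≤ (φ q₁ + ε) / ψ q₀ * ψ q := mul_nonneg (by positivity) (hψ0 q hq)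
      linarith

/-- A continuous linear operator on a finite-dimensional real inner product space whose quadratic
form is positive away from the origin is coercive. -/
lemma ContinuousLinearMap.exists_mul_sq_norm_le_inner {E : Type*} [NormedAddCommGroup E]
    [InnerProductSpace ℝ E] [FiniteDimensional ℝ E] (S : E →L[ℝ] E)
    (hpos : ∀ x, x ≠ 0 → 0 < ⟪x, S x⟫) : ∃ c > 0, ∀ x, c * ‖x‖ ^ 2 ≤ ⟪x, S x⟫ := by
  rcases subsingleton_or_nontrivial E with hE | hE
  · exact ⟨1, one_pos, fun x => by simp [Subsingleton.elim x 0]⟩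
  · have hc : Continuous fun x : E => ⟪x, S x⟫ := by fun_prop
    obtain ⟨x₀, hx₀, hmin⟩ := (isCompact_sphere (0 : E) 1).exists_isMinOn
      (NormedSpace.sphere_nonempty.2 zero_le_one) hc.continuousOn
    have hx₀1 : ‖x₀‖ = 1 := by simpa using hx₀
    refine ⟨⟪x₀, S x₀⟫, hpos x₀ (by rintro rfl; simp at hx₀1), fun x => ?_⟩
    rcases eq_or_ne x 0 with rfl | hx
    · simp
    · have hn : 0 < ‖x‖ := norm_pos_iff.2 hx
      have h1 : ⟪x₀, S x₀⟫ ≤ ⟪‖x‖⁻¹ • x, S (‖x‖⁻¹ • x)⟫ :=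
        hmin (by simp [norm_smul, hn.ne'])
      rw [map_smul, inner_smul_left, inner_smul_right] at h1
      calc ⟪x₀, S x₀⟫ * ‖x‖ ^ 2
          ≤ ((starRingEnd ℝ) ‖x‖⁻¹ * (‖x‖⁻¹ * ⟪x, S x⟫)) * ‖x‖ ^ 2 := by gcongr
        _ = ⟪x, S x⟫ := by
          simp only [conj_trivial]
          field_simp

/-- The increment of a primitive is bounded by the length of the interval times an almost
everywhere upper bound of the integrand. -/
lemma intervalIntegral_le_mul_of_ae_le {a T β : ℝ} (haT : a ≤ T) {φ : ℝ → ℝ}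
    (hφ : IntervalIntegrable φ volume a T)
    (h : ∀ᵐ t ∂(volume.restrict (Icc a T)), φ t ≤ β) :
    ∫ t in a..T, φ t ≤ (T - a) * β := by
  have := intervalIntegral.integral_mono_ae_restrict haT hφ
    (intervalIntegrable_const (c := β)) h
  simpa using this

/-- If the velocity of a curve grows at most linearly with the distance to the origin, then on a
short interval its displacement is controlled by its initial position. -/
lemma norm_sub_le_of_ae_norm_le_linear {E : Type*} [NormedAddCommGroup E] [NormedSpace ℝ E]
    {x x' : ℝ → E} {a T L v : ℝ} (haT : a ≤ T) (hL : 0 ≤ L) (hv : 0 ≤ v)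
    (hLT : (T - a) * L ≤ 1 / 2) (hx' : IntervalIntegrable x' volume a T)
    (hx : ∀ t ∈ Icc a T, x t - x a = ∫ s in a..t, x' s)
    (hbd : ∀ᵐ t ∂(volume.restrict (Icc a T)), ‖x' t‖ ≤ L * (‖x t‖ + v)) :
    ∀ t ∈ Icc a T, ‖x t - x a‖ ≤ 2 * L * (T - a) * (‖x a‖ + v) := by
  have hcont : ContinuousOn x (Icc a T) := by
    have h1 : ContinuousOn (fun t => x a + ∫ s in a..t, x' s) (Icc a T) := by
      rw [← uIcc_of_le haT]
      refine continuousOn_const.add ?_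
      refine intervalIntegral.continuousOn_primitive_interval ?_
      rw [uIcc_of_le haT]
      exact (intervalIntegrable_iff_integrableOn_Icc_of_le haT).1 hx'
    refine h1.congr fun t ht => ?_
    simp only [← hx t ht, add_sub_cancel]
  obtain ⟨t₀, ht₀, hmax⟩ := isCompact_Icc.exists_isMaxOn (nonempty_Icc.2 haT)
    (hcont.sub continuousOn_const).norm (f := fun t => ‖x t - x a‖)
  set m := ‖x t₀ - x a‖ with hm
  have hm_le : ∀ t ∈ Icc a T, ‖x t - x a‖ ≤ m := fun t ht => hmax ht
  have hae : ∀ᵐ s, s ∈ uIoc a t₀ → ‖x' s‖ ≤ L * (‖x a‖ + m + v) := by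
    filter_upwards [(ae_restrict_iff' measurableSet_Icc).1 hbd] with s hs hsI
    rw [uIoc_of_le ht₀.1] at hsI
    have hsT : s ∈ Icc a T := ⟨hsI.1.le, hsI.2.trans ht₀.2⟩
    refine (hs hsT).trans ?_
    have h1 : ‖x s‖ ≤ ‖x a‖ + m := by
      have := norm_le_norm_add_norm_sub' (x s) (x a)
      linarith [hm_le s hsT]
    gcongr
  have h1 : m ≤ L * (‖x a‖ + m + v) * |t₀ - a| := by
    have h := intervalIntegral.norm_integral_le_of_norm_le_const_ae hae
    rwa [← hx t₀ ht₀] at h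
  have hm0 : 0 ≤ m := norm_nonneg _
  have h2 : m ≤ L * (‖x a‖ + m + v) * (T - a) := by
    refine h1.trans ?_
    rw [abs_of_nonneg (by linarith [ht₀.1])]
    have := ht₀.2
    gcongr
  intro t ht
  have h3 : m * ((T - a) * L) ≤ m * (1 / 2) := by gcongr
  nlinarith [hm_le t ht]

/-- Euler-type estimates on a single sampling interval for a controlled system
`ẋ = F(d,x,u)`, `ż = G(d,x,u)` with frozen control `u`: the displacement is of the order of the
length of the interval, and the increment of a linear functional of the state is bounded by its
worst-case initial slope up to a quadratic error. -/
lemma sampled_euler_estimates {Δ E : Type*} [NormedAddCommGroup E] [InnerProductSpace ℝ E]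
    [CompleteSpace E] {D : Set Δ} {Q : Set E} {F : Δ → E → E} {G : Δ → E → ℝ}
    {L v a T : ℝ} (hL : 0 ≤ L) (hv : 0 ≤ v) (haT : a ≤ T) (hLT : (T - a) * L ≤ 1 / 2)
    (hF : ∀ d ∈ D, ∀ x ∈ Q, ∀ w ∈ Q, ‖F d x - F d w‖ ≤ L * ‖x - w‖)
    (hG : ∀ d ∈ D, ∀ x ∈ Q, ∀ w ∈ Q, |G d x - G d w| ≤ L * ‖x - w‖)
    (hF' : ∀ d ∈ D, ∀ x ∈ Q, ‖F d x‖ ≤ L * (‖x‖ + v))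
    (hG' : ∀ d ∈ D, ∀ x ∈ Q, |G d x| ≤ L * (‖x‖ + v))
    {d : ℝ → Δ} (hd : ∀ t, d t ∈ D) {x x' : ℝ → E} {z z' : ℝ → ℝ}
    (hQ : ∀ t ∈ Icc a T, x t ∈ Q)
    (hx' : IntervalIntegrable x' volume a T) (hz' : IntervalIntegrable z' volume a T)
    (hx : ∀ t ∈ Icc a T, x t - x a = ∫ s in a..t, x' s)
    (hz : ∀ t ∈ Icc a T, z t - z a = ∫ s in a..t, z' s)
    (hode : ∀ᵐ t ∂(volume.restrict (Icc a T)),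
      x' t = F (d t) (x t) ∧ z' t = G (d t) (x t)) :
    ‖x T - x a‖ ≤ 2 * L * (T - a) * (‖x a‖ + v) ∧
    |z T - z a| ≤ 2 * L * (T - a) * (‖x a‖ + v) ∧
    ∀ (α : ℝ) (w : E) (β : ℝ), (∀ d ∈ D, α * G d (x a) + ⟪w, F d (x a)⟫ ≤ β) →
      α * (z T - z a) + ⟪w, x T - x a⟫ ≤
        (T - a) * (β + (|α| + ‖w‖) * (L * (2 * L * (T - a) * (‖x a‖ + v)))) := by
  have haI : a ∈ Icc a T := left_mem_Icc.2 haT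
  have hTI : T ∈ Icc a T := right_mem_Icc.2 haT
  have hs : 0 ≤ T - a := sub_nonneg.2 haT
  have hmemI : ∀ᵐ t ∂(volume.restrict (Icc a T)), t ∈ Icc a T :=
    ae_restrict_mem measurableSet_Icc
  have hdisp : ∀ t ∈ Icc a T, ‖x t - x a‖ ≤ 2 * L * (T - a) * (‖x a‖ + v) := by
    refine norm_sub_le_of_ae_norm_le_linear haT hL hv hLT hx' hx ?_
    filter_upwards [hode, hmemI] with t ht htI
    rw [ht.1]
    exact hF' _ (hd t) _ (hQ t htI)
  have hN : 0 ≤ ‖x a‖ + v := by positivity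
  refine ⟨hdisp T hTI, ?_, fun α w β hβ => ?_⟩
  · have hzbd : ∀ᵐ t ∂(volume.restrict (Icc a T)), |z' t| ≤ L * (2 * (‖x a‖ + v)) := by
      filter_upwards [hode, hmemI] with t ht htI
      rw [ht.2]
      refine (hG' _ (hd t) _ (hQ t htI)).trans ?_
      have h1 : ‖x t‖ ≤ ‖x a‖ + ‖x t - x a‖ := norm_le_norm_add_norm_sub' _ _
      have h2 := hdisp t htI
      have h3 : (T - a) * L * (‖x a‖ + v) ≤ 1 / 2 * (‖x a‖ + v) := by gcongr
      gcongr
      linarith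
    rw [hz T hTI, abs_le]
    have hup := intervalIntegral_le_mul_of_ae_le haT hz'
      (hzbd.mono fun t ht => (abs_le.1 ht).2)
    have hlo := intervalIntegral_le_mul_of_ae_le haT hz'.neg
      (hzbd.mono fun t ht => show -z' t ≤ _ from neg_le.1 (abs_le.1 ht).1)
    have hneg : ∫ t in a..T, (-z') t = -∫ t in a..T, z' t := by
      simp only [Pi.neg_apply, intervalIntegral.integral_neg]
    rw [hneg] at hlo
    constructor <;> linarith
  · have hint : IntervalIntegrable (fun t => α * z' t + ⟪w, x' t⟫) volume a T :=
      (hz'.const_mul α).add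
        ⟨hx'.1.const_inner w, hx'.2.const_inner w⟩
    have hcomm : ∫ t in a..T, ⟪w, x' t⟫ = ⟪w, ∫ t in a..T, x' t⟫ :=
      (innerSL ℝ w).intervalIntegral_comp_comm hx'
    have heq : α * (z T - z a) + ⟪w, x T - x a⟫ = ∫ t in a..T, (α * z' t + ⟪w, x' t⟫) := by
      rw [intervalIntegral.integral_add (hz'.const_mul α)
        ⟨hx'.1.const_inner w, hx'.2.const_inner w⟩, hcomm,
        intervalIntegral.integral_const_mul, ← hx T hTI, ← hz T hTI]
    rw [heq]
    refine intervalIntegral_le_mul_of_ae_le haT hint ?_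
    filter_upwards [hode, hmemI] with t ht htI
    rw [ht.1, ht.2]
    have h1 := hβ _ (hd t)
    have h2 := hdisp t htI
    have h3 := hF _ (hd t) _ (hQ t htI) _ (hQ a haI)
    have h4 := hG _ (hd t) _ (hQ t htI) _ (hQ a haI)
    have h5 : α * (G (d t) (x t) - G (d t) (x a)) ≤
        |α| * (L * (2 * L * (T - a) * (‖x a‖ + v))) := by
      refine (le_abs_self _).trans ?_
      rw [abs_mul]
      gcongr
      exact h4.trans (by gcongr)
    have h6 : ⟪w, F (d t) (x t) - F (d t) (x a)⟫ ≤
        ‖w‖ * (L * (2 * L * (T - a) * (‖x a‖ + v))) := by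
      refine (real_inner_le_norm _ _).trans ?_
      gcongr
      exact h3.trans (by gcongr)
    rw [inner_sub_right] at h6
    linarith

/-- A locally Lipschitz vector field vanishing at the origin is, uniformly over a compact set of
parameters, states and controls, Lipschitz in the state and of linear growth. -/
lemma LocallyLipschitz.exists_bound_of_compact {Δ E Y : Type*} [PseudoMetricSpace Δ]
    [NormedAddCommGroup E] [NormedAddCommGroup Y] {D : Set Δ} (hD : IsCompact D) {Q : Set E}
    (hQ : IsCompact Q) (hQ0 : (0 : E) ∈ Q) {U : ℝ} (hU : 0 ≤ U) {F : Δ → E → ℝ → Y}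
    (hF : LocallyLipschitz fun q : Δ × E × ℝ => F q.1 q.2.1 q.2.2)
    (hF0 : ∀ d ∈ D, F d 0 0 = 0) :
    ∃ L ≥ 0, ∀ d ∈ D, ∀ u, |u| ≤ U →
      (∀ x ∈ Q, ∀ w ∈ Q, ‖F d x u - F d w u‖ ≤ L * ‖x - w‖) ∧
      ∀ x ∈ Q, ‖F d x u‖ ≤ L * (‖x‖ + |u|) := by
  obtain ⟨L, hL⟩ := (hF.locallyLipschitzOn (s := D ×ˢ Q ×ˢ Icc (-U) U))
    |>.exists_lipschitzOnWith_of_compact (hD.prod (hQ.prod isCompact_Icc))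
  refine ⟨L, L.2, fun d hd u hu => ⟨fun x hx w hw => ?_, fun x hx => ?_⟩⟩
  · have h := hL.dist_le_mul (d, x, u) ⟨hd, hx, abs_le.1 hu⟩ (d, w, u) ⟨hd, hw, abs_le.1 hu⟩
    simpa [Prod.dist_eq, dist_eq_norm] using h
  · have h := hL.dist_le_mul (d, x, u) ⟨hd, hx, abs_le.1 hu⟩ (d, 0, 0)
      ⟨hd, hQ0, by simpa using hU⟩
    simp only [Prod.dist_eq, dist_self, dist_eq_norm, hF0 d hd, sub_zero, Prod.mk_sub_mk,
      Prod.norm_mk] at h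
    refine h.trans ?_
    gcongr
    exact max_le (by positivity) (max_le (by linarith [abs_nonneg u])
      (by rw [Real.norm_eq_abs]; linarith [norm_nonneg x]))

/-- Finitely many smallness conditions that are linear in the step size hold for all small
steps. -/
lemma exists_pos_forall_mul_le {ι : Type*} [Finite ι] (A B : ι → ℝ) (hB : ∀ i, 0 < B i) :
    ∃ r > 0, ∀ s, 0 ≤ s → s ≤ r → ∀ i, s * A i ≤ B i := by
  have h : ∀ᶠ s : ℝ in 𝓝 0, ∀ i, s * A i < B i := by
    refine eventually_all.2 fun i => ?_
    have hc : Continuous fun s : ℝ => s * A i := by fun_prop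
    exact hc.continuousAt.eventually_lt_const (by simpa using hB i)
  obtain ⟨ε, hε, hball⟩ := Metric.eventually_nhds_iff.1 h
  refine ⟨ε / 2, by positivity, fun s hs hsr i => (hball ?_ i).le⟩
  rw [Real.dist_eq, sub_zero, abs_of_nonneg hs]
  linarith

/-- A continuous function on an interval that starts below a level and cannot reach it stays
below it. -/
lemma ContinuousOn.forall_lt_of_bootstrap {W : ℝ → ℝ} {a b B : ℝ}
    (hW : ContinuousOn W (Icc a b)) (ha : W a < B)
    (hstep : ∀ T ∈ Ioc a b, (∀ t ∈ Icc a T, W t ≤ B) → W T < B) :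
    ∀ t ∈ Icc a b, W t < B := by
  by_contra! hcon
  obtain ⟨t₁, ht₁, hWt₁⟩ := hcon
  have hK : IsCompact (Icc a b ∩ W ⁻¹' Ici B) :=
    isCompact_Icc.of_isClosed_subset (hW.preimage_isClosed_of_isClosed isClosed_Icc isClosed_Ici)
      inter_subset_left
  obtain ⟨T, hT, hmin⟩ := hK.exists_isLeast ⟨t₁, ht₁, hWt₁⟩
  have hlt : ∀ t ∈ Ico a T, W t < B := by
    intro t ht
    by_contra! h
    have := hmin ⟨⟨ht.1, ht.2.le.trans hT.1.2⟩, h⟩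
    linarith [ht.2]
  have haT : a < T := by
    rcases hT.1.1.eq_or_lt with h | h
    · have h2 : B ≤ W T := hT.2
      rw [← h] at h2
      linarith
    · exact h
  have hWT : W T ≤ B := by
    have hcl : T ∈ closure (Ico a T) := by
      rw [closure_Ico haT.ne]
      exact right_mem_Icc.2 haT.le
    refine ContinuousWithinAt.closure_le hcl
      ((hW T hT.1).mono fun t ht => ⟨ht.1, ht.2.le.trans hT.1.2⟩)
      continuousWithinAt_const fun t ht => (hlt t ht).le
  have h2 : B ≤ W T := hT.2
  have h3 := hstep T ⟨haT, hT.1.2⟩ fun t ht => by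
    rcases ht.2.eq_or_lt with rfl | h
    · exact hWT
    · exact (hlt t ⟨ht.1, h⟩).le
  linarith

/-- A one-step decay estimate for the quadratic Lyapunov function `M / 2 * z ^ 2 + 1 / 2 * W`,
where `ζ` is the increment of `z` and `2 * q + w` the increment of `W`. -/
lemma quadratic_decay_of_increment_le {M σ δ L C C' N s z ζ W q w : ℝ} (hM : 0 < M)
    (hσ : 0 ≤ σ) (hδ : 0 < δ) (hL : 0 ≤ L) (hC : 0 ≤ C) (hs : 0 ≤ s) (hW : 0 ≤ W)
    (hlin : M * z * ζ + q ≤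
      s * (-(δ * z ^ 2) - δ * W + (M * N + σ * N) * (L * (s * (C * N)))))
    (hζ : ζ ^ 2 ≤ (s * (C * N)) ^ 2) (hw : w ≤ σ * (s * (C * N)) ^ 2)
    (hN : N ^ 2 ≤ C' * (z ^ 2 + W))
    (hsmall : s * ((M + σ) * (L * C + C ^ 2) * C') ≤ δ / 2) :
    M / 2 * (z + ζ) ^ 2 + 1 / 2 * (W + 2 * q + w) ≤
      Real.exp (-(δ / (2 * (1 + M))) * s) * (M / 2 * z ^ 2 + 1 / 2 * W) := by
  have hV₂ : 0 ≤ z ^ 2 + W := by positivity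
  have herr : s * (s * ((M + σ) * (L * C + C ^ 2)) * N ^ 2) ≤ s * (δ / 2 * (z ^ 2 + W)) := by
    refine mul_le_mul_of_nonneg_left ?_ hs
    calc s * ((M + σ) * (L * C + C ^ 2)) * N ^ 2
        ≤ s * ((M + σ) * (L * C + C ^ 2)) * (C' * (z ^ 2 + W)) := by gcongr
      _ = s * ((M + σ) * (L * C + C ^ 2) * C') * (z ^ 2 + W) := by ring
      _ ≤ δ / 2 * (z ^ 2 + W) := by gcongr
  have hV : M / 2 * z ^ 2 + 1 / 2 * W ≤ (1 + M) * (z ^ 2 + W) := by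
    linarith [mul_nonneg hM.le hW, mul_nonneg hM.le (sq_nonneg z), sq_nonneg z]
  have hVrate : δ / (2 * (1 + M)) * (M / 2 * z ^ 2 + 1 / 2 * W) ≤ δ / 2 * (z ^ 2 + W) :=
    calc δ / (2 * (1 + M)) * (M / 2 * z ^ 2 + 1 / 2 * W)
        ≤ δ / (2 * (1 + M)) * ((1 + M) * (z ^ 2 + W)) := by gcongr
      _ = δ / 2 * (z ^ 2 + W) := by field_simp
  have hrate := mul_le_mul_of_nonneg_left hVrate hs
  have hV0 : 0 ≤ M / 2 * z ^ 2 + 1 / 2 * W := by positivity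
  refine le_trans ?_
    (mul_le_mul_of_nonneg_right (Real.add_one_le_exp (-(δ / (2 * (1 + M))) * s)) hV0)
  have hζ' : M / 2 * ζ ^ 2 ≤ M / 2 * (s * (C * N)) ^ 2 := by gcongr
  have hpos : 0 ≤ (M + σ) / 2 * (s * (C * N)) ^ 2 := by positivity
  generalize δ / (2 * (1 + M)) = μ at *
  linarith

set_option maxHeartbeats 1000000 in
/-- Invariance and exponential decay over one sampling interval, for a controlled system
`ẋ = F(d,x,u)`, `ż = G(d,x,u)` with sampled feedback `u = p'x - Kβωz`. -/
lemma exists_sampling_period_of_strict_decay {Δ E : Type*} [PseudoMetricSpace Δ]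
    [NormedAddCommGroup E] [InnerProductSpace ℝ E] [FiniteDimensional ℝ E]
    {D : Set Δ} (hD : IsCompact D) {F : Δ → E → ℝ → E} {G : Δ → E → ℝ → ℝ}
    (hF : LocallyLipschitz fun q : Δ × E × ℝ => F q.1 q.2.1 q.2.2)
    (hG : LocallyLipschitz fun q : Δ × E × ℝ => G q.1 q.2.1 q.2.2)
    (hF0 : ∀ d ∈ D, F d 0 0 = 0) (hG0 : ∀ d ∈ D, G d 0 0 = 0)
    (S : E →L[ℝ] E) (hS : ∀ x w, ⟪S x, w⟫ = ⟪x, S w⟫) (hpos : ∀ x, x ≠ 0 → 0 < ⟪x, S x⟫)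
    (p : E) {M R K ω δ β : ℝ} (hM : 0 < M) (hK : 0 < K) (hω : 0 < ω) (hδ : 0 < δ)
    (hW : ∀ d ∈ D, ∀ x u, ⟪x, S x⟫ = R ^ 2 → |u - ⟪p, x⟫| ≤ K * |β| → ⟪S x, F d x u⟫ < 0)
    (hZ : ∀ d ∈ D, ∀ x u, ⟪x, S x⟫ ≤ R ^ 2 → |u - ⟪p, x⟫| ≤ K * |β| →
      |G d x u - β * (u - ⟪p, x⟫)| < K * β ^ 2)
    (hV : ∀ d ∈ D, ∀ x z, ⟪x, S x⟫ ≤ R ^ 2 → ω * |z| ≤ 1 →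
      M * z * G d x (⟪p, x⟫ - K * β * ω * z) + ⟪S x, F d x (⟪p, x⟫ - K * β * ω * z)⟫ ≤
        -(δ * z ^ 2) - δ * ⟪x, S x⟫) :
    ∃ r > 0, ∃ μ > 0, ∀ (a b : ℝ) (d : ℝ → Δ) (x x' : ℝ → E) (z z' : ℝ → ℝ),
      b - a ≤ r → (∀ t, d t ∈ D) →
      (∀ t ∈ Icc a b, IntervalIntegrable x' volume a t) →
      (∀ t ∈ Icc a b, IntervalIntegrable z' volume a t) →
      (∀ t ∈ Icc a b, x t - x a = ∫ s in a..t, x' s) →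
      (∀ t ∈ Icc a b, z t - z a = ∫ s in a..t, z' s) →
      (∀ᵐ t ∂(volume.restrict (Icc a b)),
        x' t = F (d t) (x t) (⟪p, x a⟫ - K * β * ω * z a) ∧
        z' t = G (d t) (x t) (⟪p, x a⟫ - K * β * ω * z a)) →
      ContinuousOn x (Icc a b) →
      ⟪x a, S (x a)⟫ < R ^ 2 → |z a| ≤ ω⁻¹ →
      ∀ t ∈ Icc a b, (⟪x t, S (x t)⟫ < R ^ 2 ∧ |z t| ≤ ω⁻¹) ∧
        M / 2 * z t ^ 2 + 1 / 2 * ⟪x t, S (x t)⟫ ≤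
          Real.exp (-μ * (t - a)) * (M / 2 * z a ^ 2 + 1 / 2 * ⟪x a, S (x a)⟫) := by
  have hWc : Continuous fun x : E => ⟪x, S x⟫ := by fun_prop
  obtain ⟨c, hc, hcoer⟩ := S.exists_mul_sq_norm_le_inner hpos
  have hcS : ∀ x, ⟪x, S x⟫ ≤ ‖S‖ * ‖x‖ ^ 2 := fun x => by
    have h1 := real_inner_le_norm x (S x)
    have h2 : ‖x‖ * ‖S x‖ ≤ ‖x‖ * (‖S‖ * ‖x‖) := by gcongr; exact S.le_opNorm x
    nlinarith
  set X := R ^ 2 / c + 1 with hX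
  have hXpos : 0 < X := by positivity
  have hnorm : ∀ x, ⟪x, S x⟫ ≤ R ^ 2 → ‖x‖ ≤ X := fun x hx => by
    have h1 : ‖x‖ ^ 2 ≤ R ^ 2 / c := by
      rw [le_div_iff₀ hc]
      linarith [hcoer x]
    nlinarith [sq_nonneg (‖x‖ - 1)]
  set Q : Set E := {x | ⟪x, S x⟫ ≤ R ^ 2} with hQdef
  have hQ : IsCompact Q :=
    (isCompact_closedBall (0 : E) X).of_isClosed_subset (isClosed_le hWc continuous_const)
      fun x hx => by simpa using hnorm x hx
  have hQ0 : (0 : E) ∈ Q := by simp only [hQdef, mem_ofPred_eq, inner_zero_left]; positivity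
  set Cu := ‖p‖ + K * |β| * ω with hCu
  have hCu0 : 0 ≤ Cu := by positivity
  set Nm := X + ω⁻¹ with hNm
  have hNm0 : 0 < Nm := by positivity
  have hU0 : 0 ≤ Cu * Nm := by positivity
  obtain ⟨L₁, hL₁, hLF⟩ := hF.exists_bound_of_compact hD hQ hQ0 hU0 hF0
  obtain ⟨L₂, hL₂, hLG⟩ := hG.exists_bound_of_compact hD hQ hQ0 hU0 hG0
  set L := L₁ + L₂ with hL
  have hL0 : 0 ≤ L := by positivity
  have hL₁L : L₁ ≤ L := by linarith
  have hL₂L : L₂ ≤ L := by linarith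
  -- uniform versions of the strict inequalities
  have hcpt : IsCompact ((D ×ˢ Q ×ˢ Icc (-(Cu * Nm)) (Cu * Nm)) ∩
      {q : Δ × E × ℝ | |q.2.2 - ⟪p, q.2.1⟫| ≤ K * |β|}) :=
    (hD.prod (hQ.prod isCompact_Icc)).inter_right
      (isClosed_le (by fun_prop) continuous_const)
  have hFc := hF.continuous
  have hGc := hG.continuous
  obtain ⟨ε, hε, C, hC, hWε⟩ := hcpt.exists_le_neg_add_mul
    (φ := fun q => ⟪S q.2.1, F q.1 q.2.1 q.2.2⟫) (ψ := fun q => R ^ 2 - ⟪q.2.1, S q.2.1⟫)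
    (by fun_prop) (by fun_prop) (fun q hq => sub_nonneg.2 hq.1.2.1)
    (fun q hq h0 => hW _ hq.1.1 _ _ (sub_eq_zero.1 h0).symm hq.2)
  obtain ⟨η, hη, C₀, -, hZη⟩ := hcpt.exists_le_neg_add_mul
    (φ := fun q => |G q.1 q.2.1 q.2.2 - β * (q.2.2 - ⟪p, q.2.1⟫)| - K * β ^ 2)
    (ψ := fun _ => 0)
    (by fun_prop) (by fun_prop) (fun q _ => le_rfl)
    (fun q hq _ => sub_neg.2 (hZ _ hq.1.1 _ _ hq.1.2.1 hq.2))
  simp only [mul_zero, add_zero] at hZη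
  set C₁ := 2 * L * (1 + Cu) with hC₁
  have hC₁0 : 0 ≤ C₁ := by positivity
  set C₂ := (M + ‖S‖) * (L * C₁ + C₁ ^ 2) with hC₂
  have hC₂0 : 0 ≤ C₂ := by positivity
  set C₃ := 2 / c + 2 with hC₃
  set C₄ := ‖S‖ * (2 * L * C₁ + C₁ ^ 2) * Nm ^ 2 with hC₄
  obtain ⟨r, hr, hsmall⟩ := exists_pos_forall_mul_le
    ![L, C₂ * C₃, 2 * C, C₄, K * β ^ 2 * ω, L * C₁ * Nm] ![1 / 2, δ / 2, 1, ε, 1, η]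
    (by simp [Fin.forall_fin_succ, hδ, hε, hη])
  refine ⟨r, hr, δ / (2 * (1 + M)), by positivity, ?_⟩
  intro a b d x x' z z' hab hd hx' hz' hx hz hode hxc hWa hza
  set u := ⟪p, x a⟫ - K * β * ω * z a with hu
  have hωz : ω * |z a| ≤ 1 := by
    have := mul_le_mul_of_nonneg_left hza hω.le
    rwa [mul_inv_cancel₀ hω.ne'] at this
  set N := ‖x a‖ + |z a| with hN
  have hN0 : 0 ≤ N := by positivity
  have hNNm : N ≤ Nm := add_le_add (hnorm _ hWa.le) hza
  have hxN : ‖x a‖ ≤ N := by linarith [abs_nonneg (z a)]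
  have hzN : |z a| ≤ N := by linarith [norm_nonneg (x a)]
  have huN : |u| ≤ Cu * N := by
    have h1 : |u| ≤ |⟪p, x a⟫| + |K * β * ω * z a| := abs_sub _ _
    have h2 : |⟪p, x a⟫| ≤ ‖p‖ * ‖x a‖ := abs_real_inner_le_norm _ _
    rw [abs_mul, abs_mul, abs_mul, abs_of_pos hK, abs_of_pos hω] at h1
    have h3 : ‖p‖ * ‖x a‖ ≤ ‖p‖ * N := by gcongr
    have h4 : K * |β| * ω * |z a| ≤ K * |β| * ω * N := by gcongr
    rw [hCu, add_mul]
    linarith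
  have huU : |u| ≤ Cu * Nm := huN.trans (by gcongr)
  have hup : |u - ⟪p, x a⟫| ≤ K * |β| := by
    have h1 : u - ⟪p, x a⟫ = -(K * β * ω * z a) := by rw [hu]; ring
    rw [h1, abs_neg, abs_mul, abs_mul, abs_mul, abs_of_pos hK, abs_of_pos hω]
    calc K * |β| * ω * |z a| = K * |β| * (ω * |z a|) := by ring
      _ ≤ K * |β| * 1 := by gcongr
      _ = K * |β| := mul_one _
  -- the conclusion at time `T` as long as the state has not left `Q` before
  have hstep : ∀ T ∈ Icc a b, (∀ t ∈ Icc a T, ⟪x t, S (x t)⟫ ≤ R ^ 2) →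
      (⟪x T, S (x T)⟫ < R ^ 2 ∧ |z T| ≤ ω⁻¹) ∧
        M / 2 * z T ^ 2 + 1 / 2 * ⟪x T, S (x T)⟫ ≤
          Real.exp (-(δ / (2 * (1 + M))) * (T - a)) *
            (M / 2 * z a ^ 2 + 1 / 2 * ⟪x a, S (x a)⟫) := by
    intro T hT hTQ
    set s := T - a with hs
    have hs0 : 0 ≤ s := sub_nonneg.2 hT.1
    have hsm := hsmall s hs0 (by linarith [hT.2])
    simp only [Fin.forall_fin_succ, Matrix.cons_val_zero, Matrix.cons_val_succ,
      IsEmpty.forall_iff, and_true] at hsm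
    obtain ⟨hs1, hs2, hs3, hs4, hs5, hs6⟩ := hsm
    have hsub : Icc a T ⊆ Icc a b := Icc_subset_Icc_right hT.2
    obtain ⟨e1, e2, e3⟩ := sampled_euler_estimates (D := D) (Q := Q)
      (F := fun d x => F d x u) (G := fun d x => G d x u) (L := L) (v := |u|)
      hL0 (abs_nonneg u) hT.1 hs1
      (fun d hd x hx w hw => ((hLF d hd u huU).1 x hx w hw).trans (by gcongr))
      (fun d hd x hx w hw => ((hLG d hd u huU).1 x hx w hw).trans (by gcongr))
      (fun d hd x hx => ((hLF d hd u huU).2 x hx).trans (by gcongr))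
      (fun d hd x hx => ((hLG d hd u huU).2 x hx).trans (by gcongr))
      hd hTQ (hx' T hT) (hz' T hT) (fun t ht => hx t (hsub ht)) (fun t ht => hz t (hsub ht))
      (ae_restrict_of_ae_restrict_of_subset hsub hode)
    have he : 2 * L * s * (‖x a‖ + |u|) ≤ s * (C₁ * N) := by
      have h1 : ‖x a‖ + |u| ≤ (1 + Cu) * N := by linarith
      calc 2 * L * s * (‖x a‖ + |u|) ≤ 2 * L * s * ((1 + Cu) * N) := by gcongr
        _ = s * (C₁ * N) := by rw [hC₁]; ring
    have e1' : ‖x T - x a‖ ≤ s * (C₁ * N) := e1.trans he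
    have e2' : |z T - z a| ≤ s * (C₁ * N) := e2.trans he
    have e3' : ∀ (α : ℝ) (w : E) (γ : ℝ),
        (∀ d ∈ D, α * G d (x a) u + ⟪w, F d (x a) u⟫ ≤ γ) →
        α * (z T - z a) + ⟪w, x T - x a⟫ ≤
          s * (γ + (|α| + ‖w‖) * (L * (s * (C₁ * N)))) := fun α w γ h =>
      (e3 α w γ h).trans (by gcongr)
    have hexp : ⟪x T, S (x T)⟫ = ⟪x a, S (x a)⟫ + 2 * ⟪S (x a), x T - x a⟫ +
        ⟪x T - x a, S (x T - x a)⟫ := by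
      simp only [map_sub, inner_sub_left, inner_sub_right, hS]
      rw [← hS (x T) (x a), real_inner_comm (x a) (S (x T))]
      ring
    have hquad : ⟪x T - x a, S (x T - x a)⟫ ≤ ‖S‖ * (s * (C₁ * N)) ^ 2 :=
      (hcS _).trans (by gcongr)
    have hSx : ‖S (x a)‖ ≤ ‖S‖ * N := (S.le_opNorm _).trans (by gcongr)
    have hmem : ∀ d ∈ D, (d, x a, u) ∈ (D ×ˢ Q ×ˢ Icc (-(Cu * Nm)) (Cu * Nm)) ∩
        {q : Δ × E × ℝ | |q.2.2 - ⟪p, q.2.1⟫| ≤ K * |β|} := fun d hd =>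
      ⟨⟨hd, hWa.le, abs_le.1 huU⟩, hup⟩
    have hWa0 : 0 ≤ ⟪x a, S (x a)⟫ := le_trans (by positivity) (hcoer (x a))
    refine ⟨⟨?_, ?_⟩, ?_⟩
    · rcases hs0.eq_or_lt with h0 | hspos
      · have : T = a := by linarith
        rwa [this]
      have h1 := e3' 0 (S (x a)) (-ε + C * (R ^ 2 - ⟪x a, S (x a)⟫)) fun d hd => by
        simpa using hWε _ (hmem d hd)
      simp only [zero_mul, zero_add, abs_zero] at h1
      have h2 : s * (‖S (x a)‖ * (L * (s * (C₁ * N)))) ≤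
          s * (‖S‖ * N * (L * (s * (C₁ * N)))) := by gcongr
      have h3 : s ^ 2 * (‖S‖ * (2 * L * C₁ + C₁ ^ 2) * N ^ 2) ≤ s ^ 2 * C₄ := by
        rw [hC₄]; gcongr
      have h4 : s * (s * C₄) ≤ s * ε := by gcongr
      have h5 : 0 ≤ (R ^ 2 - ⟪x a, S (x a)⟫) * (1 - s * (2 * C)) :=
        mul_nonneg (by linarith) (by linarith)
      have h6 : 0 < s * ε := by positivity
      have h7 : 2 * (s * (‖S‖ * N * (L * (s * (C₁ * N))))) + ‖S‖ * (s * (C₁ * N)) ^ 2 =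
          s ^ 2 * (‖S‖ * (2 * L * C₁ + C₁ ^ 2) * N ^ 2) := by ring
      rw [hexp]
      linarith
    · have hGbd : ∀ d ∈ D, |G d (x a) u + K * β ^ 2 * ω * z a| ≤ K * β ^ 2 - η := by
        intro d hd
        have h1 := hZη _ (hmem d hd)
        have h2 : G d (x a) u - β * (u - ⟪p, x a⟫) = G d (x a) u + K * β ^ 2 * ω * z a := by
          rw [hu]; ring
        simp only [h2] at h1
        linarith
      have h1 := e3' 1 0 (K * β ^ 2 - η - K * β ^ 2 * ω * z a) fun d hd => by
        have := (abs_le.1 (hGbd d hd)).2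
        simp only [one_mul, inner_zero_left]
        linarith
      have h2 := e3' (-1) 0 (K * β ^ 2 - η + K * β ^ 2 * ω * z a) fun d hd => by
        have := (abs_le.1 (hGbd d hd)).1
        simp only [inner_zero_left]
        linarith
      simp only [inner_zero_left, norm_zero, abs_one, abs_neg] at h1 h2
      have h3 : L * (s * (C₁ * N)) ≤ η := by
        refine le_trans ?_ hs6
        calc L * (s * (C₁ * N)) ≤ L * (s * (C₁ * Nm)) := by gcongr
          _ = _ := by ring
      have h4 : s * (L * (s * (C₁ * N))) ≤ s * η := by gcongr
      obtain ⟨hz1, hz2⟩ := abs_le.1 hza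
      have h5 : 0 ≤ 1 - s * (K * β ^ 2 * ω) := by linarith
      have h6 := mul_le_mul_of_nonneg_right hz2 h5
      have h7 := mul_le_mul_of_nonneg_right hz1 h5
      have h8 : ω⁻¹ * (s * (K * β ^ 2 * ω)) = s * (K * β ^ 2) := by field_simp
      rw [abs_le]
      constructor <;> linarith
    · have h1 := e3' (M * z a) (S (x a)) (-(δ * z a ^ 2) - δ * ⟪x a, S (x a)⟫) fun d hd =>
        hV d hd (x a) (z a) hWa.le hωz
      have h2 : (|M * z a| + ‖S (x a)‖) * (L * (s * (C₁ * N))) ≤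
          (M * N + ‖S‖ * N) * (L * (s * (C₁ * N))) := by
        rw [abs_mul, abs_of_pos hM]; gcongr
      have h3 : M * z a * (z T - z a) + ⟪S (x a), x T - x a⟫ ≤ s *
          (-(δ * z a ^ 2) - δ * ⟪x a, S (x a)⟫ + (M * N + ‖S‖ * N) * (L * (s * (C₁ * N)))) :=
        h1.trans (by gcongr)
      have h4 : (z T - z a) ^ 2 ≤ (s * (C₁ * N)) ^ 2 :=
        sq_le_sq' (abs_le.1 e2').1 (abs_le.1 e2').2
      have h5 : N ^ 2 ≤ C₃ * (z a ^ 2 + ⟪x a, S (x a)⟫) := by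
        have h6 : N ^ 2 ≤ 2 * (‖x a‖ ^ 2 + z a ^ 2) := by
          rw [← sq_abs (z a)]
          exact add_sq_le
        have h7 : ‖x a‖ ^ 2 ≤ 1 / c * ⟪x a, S (x a)⟫ := by
          rw [one_div, inv_mul_eq_div, le_div_iff₀ hc]
          linarith [hcoer (x a)]
        have h8 : 0 ≤ 1 / c * z a ^ 2 := by positivity
        have h9 : C₃ = 2 * (1 / c) + 2 := by rw [hC₃]; ring
        rw [h9]
        linarith
      have h6 := quadratic_decay_of_increment_le hM (norm_nonneg S) hδ hL0 hC₁0 hs0 hWa0 h3 h4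
        hquad h5 hs2
      rwa [add_sub_cancel, ← hexp] at h6
  have hinv := ContinuousOn.forall_lt_of_bootstrap (W := fun t => ⟪x t, S (x t)⟫)
    (hWc.comp_continuousOn hxc) hWa fun T hT h => (hstep T ⟨hT.1.le, hT.2⟩ h).1.1
  exact fun t ht => hstep t ht fun σ hσ => (hinv σ ⟨hσ.1, hσ.2.trans ht.2⟩).le

section Euclidean

variable {m : ℕ}

lemma ip_eq_inner (x y : EuclideanSpace ℝ (Fin m)) : ip x y = ⟪x, y⟫ := by
  simp [ip, PiLp.inner_apply, mul_comm]

lemma mulVecE_eq_toEuclideanCLM (A : Matrix (Fin m) (Fin m) ℝ) (x : EuclideanSpace ℝ (Fin m)) :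
    mulVecE A x = toEuclideanCLM (𝕜 := ℝ) A x := rfl

lemma qf_eq_inner (P : Matrix (Fin m) (Fin m) ℝ) (x : EuclideanSpace ℝ (Fin m)) :
    qf P x = ⟪x, toEuclideanCLM (𝕜 := ℝ) P x⟫ := by
  rw [qf, ip_eq_inner, mulVecE_eq_toEuclideanCLM]

lemma mulVecE_add_vecMulVec_add_smul_one (A : Matrix (Fin m) (Fin m) ℝ)
    (p x : EuclideanSpace ℝ (Fin m)) (δ : ℝ) :
    mulVecE (A + vecMulVec (vecbf m) (ef p) + δ • 1) x =
      mulVecE A x + ip p x • vecb m + δ • x := by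
  ext i
  simp [mulVecE, vecb, ip, ef, add_mulVec, vecMulVec_mulVec, smul_mulVec, dotProduct, mul_comm]

lemma Matrix.PosDef.inner_toEuclideanCLM_left {P : Matrix (Fin m) (Fin m) ℝ} (hP : P.PosDef)
    (x y : EuclideanSpace ℝ (Fin m)) :
    ⟪toEuclideanCLM (𝕜 := ℝ) P x, y⟫ = ⟪x, toEuclideanCLM (𝕜 := ℝ) P y⟫ := by
  have hPt : Pᵀ = P := by simpa using hP.isHermitian.eq
  rw [real_inner_comm, inner_toEuclideanCLM, inner_toEuclideanCLM, dotProduct_mulVec,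
    ← mulVec_transpose, hPt, dotProduct_comm]

lemma Matrix.PosDef.inner_toEuclideanCLM_pos {P : Matrix (Fin m) (Fin m) ℝ} (hP : P.PosDef)
    {x : EuclideanSpace ℝ (Fin m)} (hx : x ≠ 0) : 0 < ⟪x, toEuclideanCLM (𝕜 := ℝ) P x⟫ := by
  rw [inner_toEuclideanCLM]
  have h : (x : Fin m → ℝ) ≠ 0 := fun h => hx (by ext i; exact congrFun h i)
  simpa using hP.dotProduct_mulVec_pos h

/-- The defining property `c'(A + bp') = -(0,…,0,1)` of the vector `c`. -/
lemma ip_cvec_mulVecE {n : ℕ} {p : EuclideanSpace ℝ (Fin (n + 1))} (hc : cvec n p ≠ 0)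
    (x : EuclideanSpace ℝ (Fin (n + 1))) :
    ip (cvec n p) (mulVecE (matA (n + 1)) x) =
      -x (Fin.last n) - ip (cvec n p) (vecb (n + 1)) * ip p x := by
  set B := (matA (n + 1))ᵀ + vecMulVec (ef p) (vecbf (n + 1)) with hB
  have hdet : IsUnit B.det := by
    by_contra h
    apply hc
    ext i
    simp [cvec, ← hB, nonsing_inv_apply_not_isUnit _ h]
  have hBc : B *ᵥ ef (cvec n p) = -Pi.single (Fin.last n) 1 := by
    have : ef (cvec n p) = -(B⁻¹ *ᵥ Pi.single (Fin.last n) 1) := rfl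
    rw [this, mulVec_neg, mulVec_mulVec, mul_nonsing_inv _ hdet, one_mulVec]
  have h1 : (B *ᵥ ef (cvec n p)) ⬝ᵥ ef x = -x (Fin.last n) := by
    rw [hBc]
    simp [ef]
  rw [hB, add_mulVec, add_dotProduct, mulVec_transpose, ← dotProduct_mulVec,
    vecMulVec_mulVec] at h1
  have h2 : ip (cvec n p) (mulVecE (matA (n + 1)) x) =
      ef (cvec n p) ⬝ᵥ matA (n + 1) *ᵥ ef x := rfl
  have h3 : ip (cvec n p) (vecb (n + 1)) = vecbf (n + 1) ⬝ᵥ ef (cvec n p) := by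
    rw [dotProduct_comm]; rfl
  have h4 : ip p x = ef p ⬝ᵥ ef x := rfl
  rw [h2, h3, h4]
  simp only [op_smul_eq_smul, smul_dotProduct, smul_eq_mul] at h1
  linarith

end Euclidean

lemma sat_of_abs_le_one {s : ℝ} (hs : |s| ≤ 1) : sat s = s := by
  rw [sat, max_eq_left hs, div_one]

lemma sub_eq_intervalIntegral_of_eq_add {E : Type*} [NormedAddCommGroup E] [NormedSpace ℝ E]
    {x x' : ℝ → E} (hint : ∀ T, IntervalIntegrable x' volume 0 T)
    (hx : ∀ t, 0 ≤ t → x t = x 0 + ∫ s in (0 : ℝ)..t, x' s) {a t : ℝ} (ha : 0 ≤ a)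
    (ht : 0 ≤ t) : x t - x a = ∫ s in a..t, x' s := by
  rw [hx t ht, hx a ha, ← intervalIntegral.integral_interval_sub_left (hint t) (hint a)]
  abel

/-- An invariance and decay property that holds on each sampling interval holds globally. -/
lemma exp_decay_of_forall_sampling_interval {τ : ℕ → ℝ} (hτ0 : τ 0 = 0) (hτ : StrictMono τ)
    (hτt : Tendsto τ atTop atTop) {I : ℝ → Prop} {V : ℝ → ℝ} {μ : ℝ}
    (hstep : ∀ i, I (τ i) → ∀ t ∈ Icc (τ i) (τ (i + 1)),
      I t ∧ V t ≤ Real.exp (-μ * (t - τ i)) * V (τ i)) (hI : I 0) {t : ℝ} (ht : 0 ≤ t) :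
    I t ∧ V t ≤ Real.exp (-μ * t) * V 0 := by
  have hcomb : ∀ i t, V (τ i) ≤ Real.exp (-μ * τ i) * V 0 →
      V t ≤ Real.exp (-μ * (t - τ i)) * V (τ i) → V t ≤ Real.exp (-μ * t) * V 0 := by
    intro i t h1 h2
    calc V t ≤ Real.exp (-μ * (t - τ i)) * (Real.exp (-μ * τ i) * V 0) := h2.trans (by gcongr)
      _ = Real.exp (-μ * t) * V 0 := by
        rw [← mul_assoc, ← Real.exp_add]
        ring_nf
  have hsamp : ∀ i, I (τ i) ∧ V (τ i) ≤ Real.exp (-μ * τ i) * V 0 := by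
    intro i
    induction i with
    | zero => simpa [hτ0] using hI
    | succ i ih =>
      have h := hstep i ih.1 (τ (i + 1)) ⟨(hτ i.lt_succ_self).le, le_rfl⟩
      exact ⟨h.1, hcomb i _ ih.2 h.2⟩
  rcases ht.eq_or_lt with rfl | ht
  · simpa using hI
  obtain ⟨i, hi, hi'⟩ := hτ.exists_between_of_tendsto_atTop hτt (hτ0 ▸ ht)
  have h := hstep i (hsamp i).1 t ⟨hi.le, hi'⟩
  exact ⟨h.1, hcomb i t (hsamp i).2 h.2⟩

/-- Positive invariance of `S = {(x,y) : x'Px < R², |y + c'x| ≤ ω⁻¹}` for (3.7), together with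
the exponential decay `V(t) ≤ exp(-μt) V(0)` along solutions starting in `S`, where
`V(t) = (M/2)(y(t)+c'x(t))² + (1/2)x(t)'Px(t)`. -/
theorem invariance_and_exponential_decay (n l : ℕ)
    (D : Set (EuclideanSpace ℝ (Fin l))) (hD : D.Nonempty) (hDc : IsCompact D)
    (f : EuclideanSpace ℝ (Fin l) → EuclideanSpace ℝ (Fin (n+1)) → ℝ → EuclideanSpace ℝ (Fin (n+1)))
    (g : EuclideanSpace ℝ (Fin l) → EuclideanSpace ℝ (Fin (n+1)) → ℝ → ℝ)
    (hfLip : LocallyLipschitz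
      (fun q : EuclideanSpace ℝ (Fin l) × EuclideanSpace ℝ (Fin (n+1)) × ℝ => f q.1 q.2.1 q.2.2))
    (hgLip : LocallyLipschitz
      (fun q : EuclideanSpace ℝ (Fin l) × EuclideanSpace ℝ (Fin (n+1)) × ℝ => g q.1 q.2.1 q.2.2))
    (hf0 : ∀ d ∈ D, f d 0 0 = 0) (hg0 : ∀ d ∈ D, g d 0 0 = 0)
    (P : Matrix (Fin (n+1)) (Fin (n+1)) ℝ) (hP : P.PosDef)
    (p : EuclideanSpace ℝ (Fin (n+1)))
    (hneg : (-(P * (matA (n+1) + vecMulVec (vecbf (n+1)) (ef p))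
        + ((matA (n+1))ᵀ + vecMulVec (ef p) (vecbf (n+1))) * P)).PosDef)
    (M R K ω δ : ℝ) (hM : 0 < M) (hR : 0 < R) (hK : 0 < K) (hω : 0 < ω) (hδ : 0 < δ)
    (h33 : Cond33 D f P p R K) (h34 : Cond34 D f g P p R K)
    (h35 : Cond35 D f g P p M R K ω δ)
    (k : EuclideanSpace ℝ (Fin (n+1)) → ℝ) (hk0 : k 0 = 0)
    (hkb : ∀ C : ℝ, ∃ B : ℝ, ∀ x : EuclideanSpace ℝ (Fin (n+1)), ‖x‖ ≤ C → |k x| ≤ B) :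
    ∃ rt : ℝ, 0 < rt ∧ ∃ μ : ℝ, 0 < μ ∧
      ∀ (τ : ℕ → ℝ) (d : ℝ → EuclideanSpace ℝ (Fin l))
        (x : ℝ → EuclideanSpace ℝ (Fin (n+1))) (y : ℝ → ℝ),
        Sched rt τ → Measurable d → (∀ t : ℝ, d t ∈ D) →
        Sol37 f g (ktilde k P p R K ω) τ d x y →
        qf P (x 0) < R ^ 2 → |y 0 + ip (cvec n p) (x 0)| ≤ ω⁻¹ →
        ∀ t : ℝ, 0 ≤ t →
          (qf P (x t) < R ^ 2 ∧ |y t + ip (cvec n p) (x t)| ≤ ω⁻¹) ∧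
          M / 2 * (y t + ip (cvec n p) (x t)) ^ 2 + 1 / 2 * qf P (x t)
            ≤ Real.exp (-μ * t) *
              (M / 2 * (y 0 + ip (cvec n p) (x 0)) ^ 2 + 1 / 2 * qf P (x 0)) := by
  set c := cvec n p with hc
  set b := vecb (n + 1) with hb
  set β := ip c b with hβ
  set S := toEuclideanCLM (𝕜 := ℝ) P with hS
  set A := toEuclideanCLM (𝕜 := ℝ) (matA (n + 1)) with hA
  have hSsymm : ∀ x w, ⟪S x, w⟫ = ⟪x, S w⟫ := hP.inner_toEuclideanCLM_left
  have hβ0 : β ≠ 0 := by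
    obtain ⟨d, hd⟩ := hD
    have h := h34 d hd 0 0 (by simp [qf_eq_inner]; positivity)
      (by simp [ip_eq_inner]; positivity)
    intro h0
    rw [← hc, ← hb, ← hβ, h0] at h
    have := abs_nonneg (g d 0 0 + ip c (f d 0 0))
    linarith
  have hc0 : c ≠ 0 := by
    rintro h
    exact hβ0 (by simp [hβ, h, ip_eq_inner])
  let F : EuclideanSpace ℝ (Fin l) → EuclideanSpace ℝ (Fin (n + 1)) → ℝ →
    EuclideanSpace ℝ (Fin (n + 1)) := fun d x u => A x + f d x u + u • b
  let G : EuclideanSpace ℝ (Fin l) → EuclideanSpace ℝ (Fin (n + 1)) → ℝ → ℝ :=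
    fun d x u => x (Fin.last n) + g d x u + ⟪c, F d x u⟫
  have hG : ∀ d x u, G d x u = g d x u + ip c (f d x u) + β * (u - ip p x) := by
    intro d x u
    have h := ip_cvec_mulVecE hc0 x
    rw [ip_eq_inner, mulVecE_eq_toEuclideanCLM] at h
    simp only [G, F, inner_add_right, inner_smul_right]
    rw [h, ← ip_eq_inner, ← ip_eq_inner, ← hb, ← hβ]
    ring
  have hFLip : LocallyLipschitz fun q : EuclideanSpace ℝ (Fin l) ×
      EuclideanSpace ℝ (Fin (n + 1)) × ℝ => F q.1 q.2.1 q.2.2 := by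
    let x₁ := (ContinuousLinearMap.fst ℝ (EuclideanSpace ℝ (Fin (n + 1))) ℝ).comp
      (ContinuousLinearMap.snd ℝ (EuclideanSpace ℝ (Fin l)) _)
    let u₁ := (ContinuousLinearMap.snd ℝ (EuclideanSpace ℝ (Fin (n + 1))) ℝ).comp
      (ContinuousLinearMap.snd ℝ (EuclideanSpace ℝ (Fin l)) _)
    exact ((A.comp x₁).lipschitz.locallyLipschitz.add hfLip).add
      (u₁.smulRight b).lipschitz.locallyLipschitz
  have hGLip : LocallyLipschitz fun q : EuclideanSpace ℝ (Fin l) ×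
      EuclideanSpace ℝ (Fin (n + 1)) × ℝ => G q.1 q.2.1 q.2.2 := by
    let x₁ := (ContinuousLinearMap.fst ℝ (EuclideanSpace ℝ (Fin (n + 1))) ℝ).comp
      (ContinuousLinearMap.snd ℝ (EuclideanSpace ℝ (Fin l)) _)
    exact ((((EuclideanSpace.proj (Fin.last n)).comp x₁).lipschitz.locallyLipschitz).add
      hgLip).add ((innerSL ℝ c).lipschitz.locallyLipschitz.comp hFLip)
  have hF0 : ∀ d ∈ D, F d 0 0 = 0 := fun d hd => by simp [F, hf0 d hd]
  obtain ⟨r, hr, μ, hμ, key⟩ := exists_sampling_period_of_strict_decay hDc hFLip hGLip hF0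
    (fun d hd => by simp [G, hF0 d hd, hg0 d hd]) S hSsymm
    (fun x hx => hP.inner_toEuclideanCLM_pos hx) p (R := R) (β := β) hM hK hω hδ
    (fun d hd x u hx hu => by
      have h := h33 d hd x u (by rwa [qf_eq_inner]) (by rwa [ip_eq_inner])
      rwa [ip_eq_inner, mulVecE_eq_toEuclideanCLM, ← hSsymm] at h)
    (fun d hd x u hx hu => by
      have h := h34 d hd x u (by rwa [qf_eq_inner]) (by rwa [ip_eq_inner])
      rwa [hG, ip_eq_inner p, add_sub_cancel_right])
    (fun d hd x z hx hz => by
      have h := h35 d hd x z (by rwa [qf_eq_inner]) hz _ rfl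
      rw [mulVecE_add_vecMulVec_add_smul_one] at h
      simp only [ip_eq_inner, mulVecE_eq_toEuclideanCLM, map_add, map_smul, inner_add_right,
        inner_smul_right, ← hS, ← hA, ← hc, ← hb] at h
      have hxb : ⟪b, S x⟫ = ⟪x, S b⟫ := by rw [← hSsymm, real_inner_comm]
      simp only [hG, ip_eq_inner, F, hSsymm, map_add, map_smul, inner_add_right,
        inner_smul_right]
      simp only [ip_eq_inner] at hβ
      rw [← hβ, hxb] at h
      linarith)
  refine ⟨r, hr, μ, hμ, ?_⟩
  rintro τ d x y ⟨hτ0, hτpos, hτr, hτt⟩ - hd ⟨x', y', hx', hy', hx, hy, hode⟩ hx0 hy0 t ht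
  have hτ : StrictMono τ := strictMono_nat_of_lt_succ fun i => sub_pos.1 (hτpos i)
  have hz' : ∀ T, IntervalIntegrable (fun t => ⟪c, x' t⟫) volume 0 T := fun T =>
    ⟨(hx' T).1.const_inner c, (hx' T).2.const_inner c⟩
  refine exp_decay_of_forall_sampling_interval (τ := τ)
    (I := fun t => qf P (x t) < R ^ 2 ∧ |y t + ip c (x t)| ≤ ω⁻¹)
    (V := fun t => M / 2 * (y t + ip c (x t)) ^ 2 + 1 / 2 * qf P (x t))
    hτ0 hτ hτt ?_ ⟨hx0, hy0⟩ ht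
  rintro i ⟨hIx, hIz⟩
  have hτi : 0 ≤ τ i := hτ0 ▸ hτ.monotone i.zero_le
  have hωz : |ω * (y (τ i) + ip c (x (τ i)))| ≤ 1 := by
    rw [abs_mul, abs_of_pos hω]
    have := mul_le_mul_of_nonneg_left hIz hω.le
    rwa [mul_inv_cancel₀ hω.ne'] at this
  have hfb : ktilde k P p R K ω (x (τ i)) (y (τ i)) =
      ⟪p, x (τ i)⟫ - K * β * ω * (y (τ i) + ip c (x (τ i))) := by
    rw [ktilde, if_neg hIx.not_ge, ← hc, sat_of_abs_le_one hωz, ip_eq_inner p]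
    ring
  have hode' := hode i
  rw [hfb, Measure.restrict_congr_set Ico_ae_eq_Icc] at hode'
  have hxsub : ∀ t ∈ Icc (τ i) (τ (i + 1)), x t - x (τ i) = ∫ s in τ i..t, x' s :=
    fun t ht => sub_eq_intervalIntegral_of_eq_add hx' hx hτi (hτi.trans ht.1)
  have hx'i : ∀ t, IntervalIntegrable x' volume (τ i) t := fun t => (hx' _).symm.trans (hx' t)
  have hy'i : ∀ t, IntervalIntegrable y' volume (τ i) t := fun t => (hy' _).symm.trans (hy' t)
  have hz'i : ∀ t, IntervalIntegrable (fun t => ⟪c, x' t⟫) volume (τ i) t :=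
    fun t => (hz' _).symm.trans (hz' t)
  have h := key (τ i) (τ (i + 1)) d x x' (fun t => y t + ip c (x t))
    (fun t => y' t + ⟪c, x' t⟫) (hτr i) hd (fun t _ => hx'i t)
    (fun t _ => (hy'i t).add (hz'i t)) hxsub
    (fun t ht => by
      have h1 := (innerSL ℝ c).intervalIntegral_comp_comm (hx'i t)
      simp only [innerSL_apply_apply] at h1
      rw [intervalIntegral.integral_add (hy'i t) (hz'i t), h1, ← hxsub t ht,
        ← sub_eq_intervalIntegral_of_eq_add hy' hy hτi (hτi.trans ht.1), inner_sub_right,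
        ip_eq_inner, ip_eq_inner]
      ring)
    (by
      filter_upwards [hode'] with t ht
      have h1 : x' t = F (d t) (x t)
        (⟪p, x (τ i)⟫ - K * β * ω * (y (τ i) + ip c (x (τ i)))) := ht.1
      exact ⟨h1, by rw [ht.2, h1]⟩)
    (by
      have h1 : ContinuousOn (fun t => x 0 + ∫ s in (0 : ℝ)..t, x' s)
          (Icc (τ i) (τ (i + 1))) :=
        (continuous_const.add (intervalIntegral.continuous_primitive
          (fun a b => (hx' a).symm.trans (hx' b)) 0)).continuousOn
      exact h1.congr fun t ht => hx t (hτi.trans ht.1))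
    (by rwa [← qf_eq_inner]) hIz
  simpa only [qf_eq_inner] using h
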